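/- Let n ≥ 4 and 2 ≤ c ≤ n−2. Let φ : ℝ^n → ℝ^n be a signed coordinate permutation, i.e. φ(x) = (ε_1 x_{σ(1)}, …, ε_n x_{σ(n)}) for some permutation σ of [n] and signs ε ∈ {+1, −1}^n. Then φ maps every positive c-dimensional linear subspace of ℝ^n to a positive c-dimensional linear subspace if and only if φ belongs to the subgroup of signed coordinate permutations generated by the three maps cyc_c(x) = ((−1)^{c−1} x_n, x_1, …, x_{n−1}), rev(x) = (x_n, x_{n−1}, …, x_1), and −id(x) = (−x_1, …, −x_n). -/

import Mathlib

open Matrix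

/-- All maximal (`c × c`) minors of a `c × n` real matrix are positive. -/
def AllMinorsPos {c n : ℕ} (A : Matrix (Fin c) (Fin n) ℝ) : Prop :=
  ∀ s : Fin c → Fin n, StrictMono s → 0 < (A.submatrix id s).det

/-- All maximal (`c × c`) minors of a `c × n` real matrix are nonnegative. -/
def AllMinorsNonneg {c n : ℕ} (A : Matrix (Fin c) (Fin n) ℝ) : Prop :=
  ∀ s : Fin c → Fin n, StrictMono s → 0 ≤ (A.submatrix id s).det

/-- A `c`-dimensional linear subspace of `ℝⁿ` is positive if it is the row space of a real
`c × n` matrix of rank `c` all of whose `c × c` minors are positive. -/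
def IsPositiveSubspace {n : ℕ} (c : ℕ) (L : Submodule ℝ (Fin n → ℝ)) : Prop :=
  ∃ A : Matrix (Fin c) (Fin n) ℝ, A.rank = c ∧
    L = Submodule.span ℝ (Set.range fun i => A i) ∧ AllMinorsPos A

/-- A `c`-dimensional linear subspace of `ℝⁿ` is nonnegative if it is the row space of a real
`c × n` matrix of rank `c` all of whose `c × c` minors are nonnegative. -/
def IsNonnegSubspace {n : ℕ} (c : ℕ) (L : Submodule ℝ (Fin n → ℝ)) : Prop :=
  ∃ A : Matrix (Fin c) (Fin n) ℝ, A.rank = c ∧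
    L = Submodule.span ℝ (Set.range fun i => A i) ∧ AllMinorsNonneg A

/-- Coordinatewise imaginary part of a point of `ℂⁿ`. -/
def imPart {n : ℕ} (x : Fin n → ℂ) : Fin n → ℝ := fun i => (x i).im

/-- A subset of `ℂⁿ` is positively hyperbolic of codimension `c` if the imaginary part of any
of its points does not lie in `L \ {0}` for any positive `c`-dimensional subspace `L ⊆ ℝⁿ`. -/
def PosHyperbolic {n : ℕ} (c : ℕ) (X : Set (Fin n → ℂ)) : Prop :=
  ∀ L : Submodule ℝ (Fin n → ℝ), IsPositiveSubspace c L →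
    ∀ x ∈ X, ¬ (imPart x ∈ L ∧ imPart x ≠ 0)

/-- The signed cyclic shift `cyc_c (x) = ((-1)^(c-1) xₙ, x₁, …, x_{n-1})` on `ℝⁿ`. -/
def cycFun (n c : ℕ) : Function.End (Fin n → ℝ) :=
  fun x i => (if (i : ℕ) = 0 then ((-1 : ℝ)) ^ (c - 1) else 1) * x ((finRotate n).symm i)

/-- The reversal `rev (x) = (xₙ, x_{n-1}, …, x₁)` on `ℝⁿ`. -/
def revFun (n : ℕ) : Function.End (Fin n → ℝ) := fun x i => x i.rev

/-- The negation `-id` on `ℝⁿ`. -/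
def negFun (n : ℕ) : Function.End (Fin n → ℝ) := fun x => -x

/-- The signed coordinate permutation `x ↦ (ε₁ x_{σ(1)}, …, εₙ x_{σ(n)})`, as a linear map. -/
def signedPermLin {n : ℕ} (σ : Equiv.Perm (Fin n)) (ε : Fin n → ℝ) :
    (Fin n → ℝ) →ₗ[ℝ] (Fin n → ℝ) where
  toFun x := fun i => ε i * x (σ i)
  map_add' a b := by funext i; simp [mul_add]
  map_smul' c a := by funext i; simp [smul_eq_mul]; ring

/-- A matrix all of whose maximal minors are positive has full rank. -/
theorem AllMinorsPos.rank_eq {c n : ℕ} (hcn : c ≤ n) {A : Matrix (Fin c) (Fin n) ℝ}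
    (hA : AllMinorsPos A) : A.rank = c := by
  have h := hA (Fin.castLE hcn) (Fin.strictMono_castLE hcn)
  have h1 : LinearIndependent ℝ (A.submatrix id (Fin.castLE hcn)).row :=
    Matrix.linearIndependent_rows_of_det_ne_zero h.ne'
  have h2 : LinearIndependent ℝ A.row := by
    refine LinearIndependent.of_comp (LinearMap.funLeft ℝ ℝ (Fin.castLE hcn)) ?_
    exact h1
  simpa using h2.rank_matrix

theorem isPositiveSubspace_span {c n : ℕ} (hcn : c ≤ n) {A : Matrix (Fin c) (Fin n) ℝ}
    (hA : AllMinorsPos A) :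
    IsPositiveSubspace c (Submodule.span ℝ (Set.range fun i => A i)) :=
  ⟨A, hA.rank_eq hcn, rfl, hA⟩

/-- If all maximal minors are nonzero of the same sign, the row space is positive. -/
theorem isPositiveSubspace_span_of_sign {c n : ℕ} (hc : 0 < c) (hcn : c ≤ n)
    {A : Matrix (Fin c) (Fin n) ℝ} {κ : ℝ}
    (hA : ∀ s : Fin c → Fin n, StrictMono s → 0 < κ * (A.submatrix id s).det) :
    IsPositiveSubspace c (Submodule.span ℝ (Set.range fun i => A i)) := by
  have hκ : κ ≠ 0 := by
    rintro rfl
    simpa using hA (Fin.castLE hcn) (Fin.strictMono_castLE hcn)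
  let u : Fin c → ℝˣ := Function.update 1 ⟨0, hc⟩ (Units.mk0 κ hκ)
  have hspan : Submodule.span ℝ (Set.range fun i => A i) =
      Submodule.span ℝ (Set.range fun i => (Matrix.of fun i j => (u i : ℝ) * A i j) i) := by
    apply le_antisymm
    · rw [Submodule.span_le]
      rintro _ ⟨i, rfl⟩
      have h := Submodule.smul_mem _ ((u i : ℝ)⁻¹) (Submodule.subset_span (R := ℝ)
        (Set.mem_range_self (f := fun i => (Matrix.of fun i j => (u i : ℝ) * A i j) i) i))
      have he : A i = (u i : ℝ)⁻¹ • (Matrix.of fun i j => (u i : ℝ) * A i j) i := by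
        funext j
        simp
      rw [← he] at h
      exact h
    · rw [Submodule.span_le]
      rintro _ ⟨i, rfl⟩
      exact Submodule.smul_mem _ (u i : ℝ) (Submodule.subset_span (R := ℝ)
        (Set.mem_range_self (f := fun i => A i) i))
  rw [hspan]
  refine isPositiveSubspace_span hcn fun s hs => ?_
  have h := Matrix.det_mul_column (fun i => (u i : ℝ)) (A.submatrix id s)
  have hu : ∏ i, (u i : ℝ) = κ := by
    rw [Finset.prod_eq_single (⟨0, hc⟩ : Fin c)]
    · simp [u]
    · intro b _ hb
      simp [u, Function.update_of_ne hb]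
    · simp
  rw [hu] at h
  have h3 := hA s hs
  rw [← h] at h3
  exact h3

theorem isPositiveSubspace_map_of_sign {c n : ℕ} (hc : 0 < c) (hcn : c ≤ n)
    (g : (Fin n → ℝ) →ₗ[ℝ] (Fin n → ℝ)) (κ : ℝ)
    (hg : ∀ A : Matrix (Fin c) (Fin n) ℝ, AllMinorsPos A → ∀ s : Fin c → Fin n, StrictMono s →
      0 < κ * ((Matrix.of fun i => g (A i)).submatrix id s).det)
    {L : Submodule ℝ (Fin n → ℝ)} (hL : IsPositiveSubspace c L) :
    IsPositiveSubspace c (L.map g) := by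
  obtain ⟨A, -, rfl, hA⟩ := hL
  rw [Submodule.map_span, ← Set.range_comp]
  exact isPositiveSubspace_span_of_sign hc hcn (hg A hA)

/-- The self-maps of `ℝⁿ` that are linear and preserve positive subspaces. -/
def PreservesPositive {n : ℕ} (c : ℕ) (f : Function.End (Fin n → ℝ)) : Prop :=
  ∃ g : (Fin n → ℝ) →ₗ[ℝ] (Fin n → ℝ), ⇑g = f ∧
    ∀ L, IsPositiveSubspace c L → IsPositiveSubspace c (L.map g)

theorem preservesPositive_negFun {n c : ℕ} (hc : 0 < c) (hcn : c ≤ n) :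
    PreservesPositive c (negFun n) := by
  refine ⟨-LinearMap.id, rfl, fun L hL => ?_⟩
  refine isPositiveSubspace_map_of_sign hc hcn _ ((-1) ^ c) (fun A hA s hs => ?_) hL
  have h : (Matrix.of fun i => (-LinearMap.id : (Fin n → ℝ) →ₗ[ℝ] (Fin n → ℝ)) (A i)).submatrix
      id s = -(A.submatrix id s) := by
    ext i j; simp
  rw [h, Matrix.det_neg, Fintype.card_fin, ← mul_assoc, ← mul_pow]
  simpa using hA s hs

theorem preservesPositive_revFun {n c : ℕ} (hc : 0 < c) (hcn : c ≤ n) :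
    PreservesPositive c (revFun n) := by
  refine ⟨LinearMap.funLeft ℝ ℝ Fin.rev, rfl, fun L hL => ?_⟩
  refine isPositiveSubspace_map_of_sign hc hcn _
    ((Equiv.Perm.sign (Fin.revPerm : Equiv.Perm (Fin c)) : ℤ) : ℝ) (fun A hA s hs => ?_) hL
  have h : (Matrix.of fun i => LinearMap.funLeft ℝ ℝ Fin.rev (A i)).submatrix id s =
      (A.submatrix id fun j => (s j.rev).rev).submatrix id (Fin.revPerm : Equiv.Perm (Fin c)) := by
    ext i j; simp [LinearMap.funLeft]
  have hs' : StrictMono fun j : Fin c => (s j.rev).rev := fun i j hij =>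
    Fin.rev_lt_rev.2 (hs (Fin.rev_lt_rev.2 hij))
  rw [h, Matrix.det_permute', ← mul_assoc, ← Int.cast_mul, Int.units_coe_mul_self]
  simpa using hA _ hs'

theorem finRotate_symm_val {k : ℕ} (i : Fin (k + 1)) :
    ((finRotate (k + 1)).symm i : ℕ) = if (i : ℕ) = 0 then k else (i : ℕ) - 1 := by
  obtain ⟨j, rfl⟩ := (finRotate (k + 1)).surjective i
  rw [Equiv.symm_apply_apply, coe_finRotate]
  by_cases hj : j = Fin.last k
  · simp [hj]
  · simp [hj]

theorem preservesPositive_cycFun {n c : ℕ} (hc : 0 < c) (hcn : c ≤ n) :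
    PreservesPositive c (cycFun n c) := by
  obtain ⟨m, rfl⟩ : ∃ m, c = m + 1 := ⟨c - 1, by omega⟩
  obtain ⟨k, rfl⟩ : ∃ k, n = k + 1 := ⟨n - 1, by omega⟩
  refine ⟨signedPermLin (finRotate (k + 1)).symm
    (fun i => if (i : ℕ) = 0 then ((-1 : ℝ)) ^ (m + 1 - 1) else 1), rfl, fun L hL => ?_⟩
  refine isPositiveSubspace_map_of_sign hc hcn _ 1 (fun A hA s hs => ?_) hL
  have h := Matrix.det_mul_row (fun j => if (s j : ℕ) = 0 then ((-1 : ℝ)) ^ (m + 1 - 1) else 1)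
    (A.submatrix id fun j => (finRotate (k + 1)).symm (s j))
  have hmono : ∀ i j, i < j → (s i : ℕ) < s j := fun i j hij => hs hij
  have hprod : ∏ j, (if (s j : ℕ) = 0 then ((-1 : ℝ)) ^ (m + 1 - 1) else 1) =
      if (s 0 : ℕ) = 0 then ((-1 : ℝ)) ^ m else 1 := by
    rw [Finset.prod_eq_single (0 : Fin (m + 1))]
    · simp
    · intro b _ hb
      have := hmono 0 b (Fin.pos_of_ne_zero hb)
      rw [if_neg (by omega)]
    · simp
  rw [hprod] at h
  rw [one_mul]
  refine lt_of_lt_of_eq ?_ h.symm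
  split_ifs with h0
  · have hs' : StrictMono fun j => (finRotate (k + 1)).symm (s (finRotate (m + 1) j)) := by
      intro i j hij
      rw [Fin.lt_def, finRotate_symm_val, finRotate_symm_val]
      have hij' : (i : ℕ) < j := hij
      have hjm := j.isLt
      have hi : (finRotate (m + 1) i : ℕ) = i + 1 := by
        rw [coe_finRotate, if_neg]
        intro h; rw [h] at hij'; simp at hij'; omega
      have hi0 := hmono 0 (finRotate (m + 1) i) (by rw [Fin.lt_def, hi]; simp)
      have hib := (s (finRotate (m + 1) i)).isLt
      by_cases hj : j = Fin.last m
      · subst hj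
        rw [finRotate_last, if_pos h0, if_neg (by omega)]
        omega
      · have hj' : (finRotate (m + 1) j : ℕ) = j + 1 := by
          rw [coe_finRotate, if_neg hj]
        have := hmono (finRotate (m + 1) i) (finRotate (m + 1) j) (by rw [Fin.lt_def]; omega)
        rw [if_neg (by omega), if_neg (by omega)]
        omega
    have h1 := hA _ hs'
    have h2 := Matrix.det_permute' (finRotate (m + 1))
      (A.submatrix id fun j => (finRotate (k + 1)).symm (s j))
    rw [sign_finRotate] at h2
    have h3 : (A.submatrix id fun j => (finRotate (k + 1)).symm (s (finRotate (m + 1) j))) =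
      (A.submatrix id fun j => (finRotate (k + 1)).symm (s j)).submatrix id
        (finRotate (m + 1)) := rfl
    rw [h3, h2] at h1
    simpa using h1
  · rw [one_mul]
    refine hA _ fun i j hij => ?_
    rw [Fin.lt_def, finRotate_symm_val, finRotate_symm_val]
    have h1 := hmono i j hij
    have h2 : (s 0 : ℕ) ≤ s i := hs.monotone (Fin.zero_le i)
    rw [if_neg (by omega), if_neg (by omega)]
    omega

theorem preservesPositive_of_mem_closure {n c : ℕ} (hc : 0 < c) (hcn : c ≤ n)
    {f : Function.End (Fin n → ℝ)}
    (hf : f ∈ Submonoid.closure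
      ({cycFun n c, revFun n, negFun n} : Set (Function.End (Fin n → ℝ)))) :
    PreservesPositive c f := by
  induction hf using Submonoid.closure_induction with
  | mem x hx =>
    rcases hx with rfl | rfl | rfl
    · exact preservesPositive_cycFun hc hcn
    · exact preservesPositive_revFun hc hcn
    · exact preservesPositive_negFun hc hcn
  | one => exact ⟨LinearMap.id, rfl, fun L hL => by rwa [Submodule.map_id]⟩
  | mul x y _ _ hx hy =>
    obtain ⟨g, rfl, hg⟩ := hx
    obtain ⟨h, rfl, hh⟩ := hy
    refine ⟨g ∘ₗ h, rfl, fun L hL => ?_⟩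
    rw [Submodule.map_comp]
    exact hg _ (hh _ hL)

/-- Vectors of the row space supported at one column of each of two square matrices that differ
only in that column have entries of the same sign when both determinants are positive. -/
theorem mul_nonneg_of_vecMul_eq_single {c : ℕ} {M N : Matrix (Fin c) (Fin c) ℝ} {k : Fin c}
    (hMN : ∀ i j, j ≠ k → M i j = N i j) (hM : 0 < M.det) (hN : 0 < N.det)
    {y : Fin c → ℝ} {a b : ℝ} (ha : y ᵥ* M = Pi.single k a) (hb : y ᵥ* N = Pi.single k b) :
    0 ≤ a * b := by
  have key : ∀ (P : Matrix (Fin c) (Fin c) ℝ) (t : ℝ), y ᵥ* P = Pi.single k t →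
      ∀ r, P.det * y r = t * P.adjugate k r := by
    intro P t h r
    have h1 : (y ᵥ* P) ᵥ* P.adjugate = P.det • y := by
      rw [Matrix.vecMul_vecMul, Matrix.mul_adjugate, Matrix.vecMul_smul, Matrix.vecMul_one]
    rw [h] at h1
    have h2 := congrFun h1 r
    simp only [Matrix.single_vecMul, Pi.smul_apply, smul_eq_mul] at h2
    rw [← h2]
    simp [Matrix.row]
  have hadj : ∀ r, M.adjugate k r = N.adjugate k r := by
    intro r
    rw [← Matrix.transpose_apply M.adjugate, ← Matrix.transpose_apply N.adjugate,
      Matrix.adjugate_transpose, Matrix.adjugate_transpose, Matrix.adjugate_apply,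
      Matrix.adjugate_apply]
    congr 1
    ext i j
    by_cases hi : i = k
    · subst hi; simp
    · simp [Matrix.updateRow_ne hi, hMN j i hi]
  by_cases hy : y = 0
  · subst hy
    have := congrFun ha k
    simp at this
    simp [← this]
  · obtain ⟨r, hr⟩ := Function.ne_iff.1 hy
    have h1 := key M a ha r
    have h2 := key N b hb r
    rw [← hadj r] at h2
    have hr' : y r ≠ 0 := hr
    have hp : 0 < (M.det * y r) * (N.det * y r) := by
      have : (M.det * y r) * (N.det * y r) = M.det * N.det * (y r * y r) := by ring
      rw [this]
      have := mul_self_pos.2 hr'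
      positivity
    rw [h1, h2] at hp
    by_contra hneg
    have : a * M.adjugate k r * (b * M.adjugate k r) =
        (a * b) * (M.adjugate k r * M.adjugate k r) := by ring
    rw [this] at hp
    nlinarith [mul_self_nonneg (M.adjugate k r)]

/-- A vector of a positive subspace that vanishes at `c - 1` places does not change sign between
two neighbouring places outside of these. -/
theorem IsPositiveSubspace.mul_nonneg_of_adjacent {n c : ℕ} {L : Submodule ℝ (Fin n → ℝ)}
    (hL : IsPositiveSubspace c L) {w : Fin n → ℝ} (hw : w ∈ L) {S : Finset (Fin n)}
    (hS : S.card + 1 = c) (hwS : ∀ s ∈ S, w s = 0) {a b : Fin n} (hab : (b : ℕ) = a + 1)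
    (haS : a ∉ S) (hbS : b ∉ S) : 0 ≤ w a * w b := by
  obtain ⟨B, -, rfl, hB⟩ := hL
  obtain ⟨y, hy⟩ := (Submodule.mem_span_range_iff_exists_fun ℝ).1 hw
  have hcard : (insert a S).card = c := by rw [Finset.card_insert_of_notMem haS, hS]
  let s := (insert a S).orderEmbOfFin hcard
  have hs : StrictMono s := OrderEmbedding.strictMono _
  obtain ⟨k, hk⟩ : ∃ k, s k = a := by
    have : a ∈ Set.range s := by
      simp only [s, Finset.range_orderEmbOfFin]
      simp
    exact this
  have hsS : ∀ j, j ≠ k → s j ∈ S := by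
    intro j hj
    have h : s j ∈ insert a S := Finset.orderEmbOfFin_mem _ hcard j
    refine (Finset.mem_insert.1 h).resolve_left fun h => hj (hs.injective (h.trans hk.symm))
  have ht : StrictMono (Function.update s k b) := by
    intro i j hij
    have hlt := hs hij
    by_cases hi : i = k
    · subst hi
      rw [Function.update_self, Function.update_of_ne hij.ne']
      have : s j ≠ b := fun h => hbS (h ▸ hsS j hij.ne')
      rw [hk] at hlt
      have h1 : (s j : ℕ) ≠ b := fun h => this (Fin.ext h)
      rw [Fin.lt_def] at hlt ⊢
      omega
    · rw [Function.update_of_ne hi]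
      by_cases hj : j = k
      · subst hj
        rw [Function.update_self]
        rw [hk] at hlt
        rw [Fin.lt_def] at hlt ⊢
        omega
      · rwa [Function.update_of_ne hj]
  have hwj : ∀ j, w j = ∑ i, y i * B i j := by
    intro j
    rw [← hy]
    simp
  refine mul_nonneg_of_vecMul_eq_single (k := k) (y := y) ?_ (hB s hs) (hB _ ht) ?_ ?_
  · intro i j hj
    simp [Function.update_of_ne hj]
  · ext j
    have h : (y ᵥ* B.submatrix id s) j = w (s j) := by
      rw [hwj]; rfl
    rw [h]
    by_cases hj : j = k
    · subst hj; simp [hk]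
    · rw [hwS _ (hsS j hj), Pi.single_eq_of_ne hj]
  · ext j
    have h : (y ᵥ* B.submatrix id (Function.update s k b)) j = w (Function.update s k b j) := by
      rw [hwj]; rfl
    rw [h]
    by_cases hj : j = k
    · subst hj; simp
    · rw [Function.update_of_ne hj, hwS _ (hsS j hj), Pi.single_eq_of_ne hj]

/-- The matrix of the moment curve evaluated at `0, 1, …, n - 1`. -/
def momentMatrix (c n : ℕ) : Matrix (Fin c) (Fin n) ℝ := Matrix.of fun i j => (j : ℝ) ^ (i : ℕ)

theorem allMinorsPos_momentMatrix (c n : ℕ) : AllMinorsPos (momentMatrix c n) := by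
  intro s hs
  have h : (momentMatrix c n).submatrix id s =
      (Matrix.vandermonde fun i => ((s i : ℕ) : ℝ))ᵀ := by
    ext i j; simp [momentMatrix, Matrix.vandermonde_apply]
  rw [h, Matrix.det_transpose, Matrix.det_vandermonde]
  refine Finset.prod_pos fun i _ => Finset.prod_pos fun j hj => ?_
  have : (s i : ℕ) < s j := hs (Finset.mem_Ioi.1 hj)
  have : ((s i : ℕ) : ℝ) < (s j : ℕ) := by exact_mod_cast this
  linarith

theorem prod_sub_mem_span_momentMatrix {c n : ℕ} {ι : Type*} (S : Finset ι) (hS : S.card < c)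
    (t : ι → ℝ) : (fun j : Fin n => ∏ i ∈ S, ((j : ℝ) - t i)) ∈
      Submodule.span ℝ (Set.range fun i => momentMatrix c n i) := by
  rw [Submodule.mem_span_range_iff_exists_fun]
  let p : Polynomial ℝ := ∏ i ∈ S, (Polynomial.X - Polynomial.C (t i))
  have hp : p.natDegree < c := by
    simpa [p] using hS
  refine ⟨fun i => p.coeff i, ?_⟩
  ext j
  have h := Polynomial.eval_eq_sum_range' hp (j : ℝ)
  rw [← Fin.sum_univ_eq_sum_range (fun i => p.coeff i * (j : ℝ) ^ i)] at h
  simp only [p, Polynomial.eval_prod, Polynomial.eval_sub, Polynomial.eval_X,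
    Polynomial.eval_C] at h
  rw [h]
  simp [momentMatrix, p]

theorem prod_pos_of_preserves {n c : ℕ} (hcn : c ≤ n)
    (σ : Equiv.Perm (Fin n)) (ε : Fin n → ℝ) (hε : ∀ i, ε i = 1 ∨ ε i = -1)
    (h : ∀ L : Submodule ℝ (Fin n → ℝ), IsPositiveSubspace c L →
        IsPositiveSubspace c (L.map (signedPermLin σ ε)))
    {S : Finset (Fin n)} (hS : S.card + 1 = c) {a b : Fin n} (hab : (b : ℕ) = a + 1)
    (haS : a ∉ S) (hbS : b ∉ S) :
    0 < ε a * ε b * ∏ s ∈ S, (((σ a : ℕ) : ℝ) - (σ s : ℕ)) * (((σ b : ℕ) : ℝ) - (σ s : ℕ)) := by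
  have hL := h _ (isPositiveSubspace_span hcn (allMinorsPos_momentMatrix c n))
  have hw := Submodule.mem_map_of_mem (f := signedPermLin σ ε)
    (prod_sub_mem_span_momentMatrix (n := n) S (by omega : S.card < c)
      (fun s => ((σ s : ℕ) : ℝ)))
  have h1 := hL.mul_nonneg_of_adjacent hw hS (fun s hs => by
    simp only [signedPermLin, LinearMap.coe_mk, AddHom.coe_mk]
    rw [Finset.prod_eq_zero hs (sub_self _), mul_zero]) hab haS hbS
  simp only [signedPermLin, LinearMap.coe_mk, AddHom.coe_mk] at h1
  have hne : ∀ {x}, x ∉ S → ∀ s ∈ S, (((σ x : ℕ) : ℝ) - (σ s : ℕ)) ≠ 0 := by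
    intro x hx s hs h0
    have : (σ x : ℕ) = σ s := by exact_mod_cast sub_eq_zero.1 h0
    exact hx (σ.injective (Fin.ext this) ▸ hs)
  have hε0 : ∀ i, ε i ≠ 0 := fun i => by rcases hε i with h | h <;> rw [h] <;> norm_num
  refine lt_of_le_of_ne ?_ (Ne.symm ?_)
  · rw [Finset.prod_mul_distrib]
    linarith
  · exact mul_ne_zero (mul_ne_zero (hε0 a) (hε0 b))
      (Finset.prod_ne_zero_iff.2 fun s hs => mul_ne_zero (hne haS s hs) (hne hbS s hs))

/-- If the product of `g` over every `m`-subset of `T` has the same sign, with `0 < m < #T`,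
then the values of `g` on `T` have the same sign. -/
theorem mul_pos_of_prod_pos {α : Type*} [DecidableEq α] {T : Finset α} {g : α → ℝ} {m : ℕ} {κ : ℝ}
    (hm : 0 < m) (hmT : m < T.card) (h : ∀ S ⊆ T, S.card = m → 0 < κ * ∏ s ∈ S, g s)
    {x y : α} (hx : x ∈ T) (hy : y ∈ T) (hxy : x ≠ y) : 0 < g x * g y := by
  have hcard : m - 1 ≤ ((T.erase x).erase y).card := by
    rw [Finset.card_erase_of_mem (Finset.mem_erase.2 ⟨hxy.symm, hy⟩), Finset.card_erase_of_mem hx]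
    omega
  obtain ⟨R, hR, hRc⟩ := Finset.exists_subset_card_eq hcard
  have hxR : x ∉ R := fun hh => by simpa using hR hh
  have hyR : y ∉ R := fun hh => by simpa using hR hh
  have hRT : R ⊆ T := fun z hz => by
    have := hR hz
    simp only [Finset.mem_erase] at this
    exact this.2.2
  have h1 := h (insert x R) (Finset.insert_subset hx hRT)
    (by rw [Finset.card_insert_of_notMem hxR]; omega)
  have h2 := h (insert y R) (Finset.insert_subset hy hRT)
    (by rw [Finset.card_insert_of_notMem hyR]; omega)
  rw [Finset.prod_insert hxR] at h1
  rw [Finset.prod_insert hyR] at h2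
  have h3 := mul_pos h1 h2
  by_contra hneg
  have h4 : κ * (g x * ∏ s ∈ R, g s) * (κ * (g y * ∏ s ∈ R, g s)) =
    (g x * g y) * (κ * ∏ s ∈ R, g s) ^ 2 := by ring
  rw [h4] at h3
  nlinarith [sq_nonneg (κ * ∏ s ∈ R, g s)]

/-- `b` follows `a` cyclically, and the signs change as for the signed cyclic shift. -/
def CyclicStep (n c : ℕ) (a b : ℕ) (e : ℝ) : Prop :=
  (b = a + 1 ∧ 0 < e) ∨ (a + 1 = n ∧ b = 0 ∧ 0 < e * (-1) ^ (c - 1))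

theorem cyclicStep_or_of_preserves {n c : ℕ} (hc1 : 2 ≤ c) (hc2 : c + 2 ≤ n)
    (σ : Equiv.Perm (Fin n)) (ε : Fin n → ℝ) (hε : ∀ i, ε i = 1 ∨ ε i = -1)
    (h : ∀ L : Submodule ℝ (Fin n → ℝ), IsPositiveSubspace c L →
        IsPositiveSubspace c (L.map (signedPermLin σ ε)))
    {a b : Fin n} (hab : (b : ℕ) = a + 1) :
    CyclicStep n c (σ a) (σ b) (ε a * ε b) ∨ CyclicStep n c (σ b) (σ a) (ε a * ε b) := by
  have hne : a ≠ b := fun hh => by rw [hh] at hab; omega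
  have hσne : (σ a : ℕ) ≠ σ b := fun hh => hne (σ.injective (Fin.ext hh))
  let T : Finset (Fin n) := (Finset.univ.erase a).erase b
  have hT : T.card = n - 2 := by
    rw [Finset.card_erase_of_mem (by simp [hne.symm]), Finset.card_erase_of_mem (by simp)]
    simp; omega
  have hmemT : ∀ {x}, x ∈ T ↔ x ≠ b ∧ x ≠ a := by intro x; simp [T]
  let g : Fin n → ℝ := fun s => (((σ a : ℕ) : ℝ) - (σ s : ℕ)) * (((σ b : ℕ) : ℝ) - (σ s : ℕ))
  have hprod : ∀ S ⊆ T, S.card = c - 1 → 0 < (ε a * ε b) * ∏ s ∈ S, g s := by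
    intro S hST hS
    exact prod_pos_of_preserves (by omega) σ ε hε h (by omega) hab
      (fun hh => (hmemT.1 (hST hh)).2 rfl) (fun hh => (hmemT.1 (hST hh)).1 rfl)
  have hsign : ∀ x ∈ T, ∀ y ∈ T, x ≠ y → 0 < g x * g y := fun x hx y hy hxy =>
    mul_pos_of_prod_pos (by omega) (by omega) hprod hx hy hxy
  obtain ⟨S, hST, hS⟩ := Finset.exists_subset_card_eq (by omega : c - 1 ≤ T.card)
  have hS0 := hprod S hST hS
  have hval : ∀ v : ℕ, v < n → v ≠ σ a → v ≠ σ b → ∃ x ∈ T, (σ x : ℕ) = v := by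
    intro v hv hva hvb
    refine ⟨σ.symm ⟨v, hv⟩, hmemT.2 ⟨?_, ?_⟩, by simp⟩
    · rintro rfl; simp at hvb
    · rintro rfl; simp at hva
  have hpos : ∀ x, (σ x : ℕ) < σ a ∧ (σ x : ℕ) < σ b ∨ (σ a : ℕ) < σ x ∧ (σ b : ℕ) < σ x →
      0 < g x := by
    rintro x (⟨h1, h2⟩ | ⟨h1, h2⟩)
    · exact mul_pos (sub_pos.2 (by exact_mod_cast h1)) (sub_pos.2 (by exact_mod_cast h2))
    · exact mul_pos_of_neg_of_neg (sub_neg.2 (by exact_mod_cast h1))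
        (sub_neg.2 (by exact_mod_cast h2))
  have hneg : ∀ x, (σ x : ℕ) < σ a ∧ (σ b : ℕ) < σ x ∨ (σ a : ℕ) < σ x ∧ (σ x : ℕ) < σ b →
      g x < 0 := by
    rintro x (⟨h1, h2⟩ | ⟨h1, h2⟩)
    · exact mul_neg_of_pos_of_neg (sub_pos.2 (by exact_mod_cast h1))
        (sub_neg.2 (by exact_mod_cast h2))
    · exact mul_neg_of_neg_of_pos (sub_neg.2 (by exact_mod_cast h1))
        (sub_pos.2 (by exact_mod_cast h2))
  have ha := (σ a).isLt
  have hb := (σ b).isLt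
  have hdich : (∀ x ∈ T, 0 < g x) ∨ (∀ x ∈ T, g x < 0) := by
    have hne0 : ∀ x ∈ T, g x ≠ 0 := by
      intro x hx h0
      obtain ⟨y, hy, hyx⟩ := Finset.exists_mem_ne (by omega : 1 < T.card) x
      have := hsign x hx y hy hyx.symm
      rw [h0] at this
      simp at this
    by_contra! hcon
    obtain ⟨⟨x, hx, hgx⟩, ⟨y, hy, hgy⟩⟩ := hcon
    have hxy : x ≠ y := by
      rintro rfl
      exact hne0 x hx (le_antisymm hgx hgy)
    have := hsign x hx y hy hxy
    nlinarith
  rcases hdich with hall | hall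
  · have he : 0 < ε a * ε b :=
      pos_of_mul_pos_left hS0 (Finset.prod_pos fun s hs => hall s (hST hs)).le
    have hno : ∀ v : ℕ, ¬ ((v < σ a ∧ (σ b : ℕ) < v) ∨ ((σ a : ℕ) < v ∧ v < σ b)) := by
      intro v hv
      obtain ⟨x, hx, rfl⟩ := hval v (by omega) (by omega) (by omega)
      exact lt_asymm (hall x hx) (hneg x hv)
    have h1 := hno (σ a + 1)
    have h2 := hno (σ b + 1)
    by_cases hlt : (σ a : ℕ) < σ b
    · exact Or.inl (Or.inl ⟨by omega, he⟩)
    · exact Or.inr (Or.inl ⟨by omega, he⟩)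
  · have he : 0 < ε a * ε b * (-1) ^ (c - 1) := by
      have hp : ∏ s ∈ S, g s = (-1) ^ (c - 1) * ∏ s ∈ S, (-g s) := by
        rw [Finset.prod_neg, hS, ← mul_assoc, ← mul_pow]
        simp
      rw [hp, ← mul_assoc] at hS0
      exact pos_of_mul_pos_left hS0
        (Finset.prod_pos fun s hs => neg_pos.2 (hall s (hST hs))).le
    have hno : ∀ v : ℕ, v < n → ¬ ((v < σ a ∧ v < σ b) ∨ ((σ a : ℕ) < v ∧ (σ b : ℕ) < v)) := by
      intro v hvn hv
      obtain ⟨x, hx, rfl⟩ := hval v hvn (by omega) (by omega)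
      exact lt_asymm (hall x hx) (hpos x hv)
    have h1 := hno 0 (by omega)
    have h2 := hno (n - 1) (by omega)
    by_cases hlt : (σ a : ℕ) < σ b
    · exact Or.inr (Or.inr ⟨by omega, by omega, he⟩)
    · exact Or.inl (Or.inr ⟨by omega, by omega, he⟩)

theorem cycFun_pow_apply {n : ℕ} (hn : 0 < n) (c k : ℕ) (hk : k ≤ n) (x : Fin n → ℝ) (i : Fin n) :
    (cycFun n c ^ k) x i = (if (i : ℕ) < k then (-1 : ℝ) ^ (c - 1) else 1) *
      x ⟨((i : ℕ) + (n - k)) % n, Nat.mod_lt _ hn⟩ := by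
  obtain ⟨N, rfl⟩ : ∃ N, n = N + 1 := ⟨n - 1, by omega⟩
  induction k generalizing i with
  | zero =>
    simp only [pow_zero, not_lt_zero, if_false, one_mul]
    change x i = _
    congr 1
    apply Fin.ext
    simp [Nat.mod_eq_of_lt i.isLt]
  | succ k ih =>
    rw [pow_succ']
    change (if (i : ℕ) = 0 then ((-1 : ℝ)) ^ (c - 1) else 1) *
      (cycFun (N + 1) c ^ k) x ((finRotate (N + 1)).symm i) = _
    rw [ih (by omega)]
    simp only [finRotate_symm_val]
    by_cases hi : (i : ℕ) = 0
    · simp only [hi, if_true]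
      simp only [if_pos (Nat.succ_pos k), if_neg (show ¬ N < k by omega), one_mul]
      congr 2
      apply Fin.ext
      have : N + (N + 1 - k) = 0 + (N + 1 - (k + 1)) + (N + 1) := by omega
      simp only [this, Nat.add_mod_right]
    · simp only [hi, if_false, one_mul]
      have h1 : (i : ℕ) - 1 + (N + 1 - k) = i + (N + 1 - (k + 1)) := by omega
      have h2 : ((i : ℕ) - 1 < k) ↔ (i : ℕ) < k + 1 := by omega
      simp only [h1, h2]

/-- A signed permutation all of whose steps are ascending cyclic steps is, up to sign, a power of
the signed cyclic shift. -/
theorem mem_closure_of_cyclicStep {n c : ℕ} (hn : 0 < n)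
    (σ : Fin n → Fin n) (ε : Fin n → ℝ) (hε : ∀ i, ε i = 1 ∨ ε i = -1)
    (h : ∀ a b : Fin n, (b : ℕ) = a + 1 → CyclicStep n c (σ a) (σ b) (ε a * ε b)) :
    (fun x : Fin n → ℝ => fun i => ε i * x (σ i)) ∈
      Submonoid.closure ({cycFun n c, revFun n, negFun n} : Set (Function.End (Fin n → ℝ))) := by
  set G := Submonoid.closure ({cycFun n c, revFun n, negFun n} : Set (Function.End (Fin n → ℝ)))
  let z : Fin n := ⟨0, hn⟩
  have hz := (σ z).isLt
  let δ : ℝ := (-1) ^ (c - 1)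
  have hδ : δ = 1 ∨ δ = -1 := neg_one_pow_eq_or ℝ _
  let k := n - (σ z : ℕ)
  have key : ∀ m (hm : m < n), (σ ⟨m, hm⟩ : ℕ) = (m + (n - k)) % n ∧
      ε ⟨m, hm⟩ = ε z * δ * (if m < k then δ else 1) := by
    intro m
    induction m with
    | zero =>
      intro hm
      refine ⟨?_, ?_⟩
      · rw [show 0 + (n - k) = σ z by omega, Nat.mod_eq_of_lt hz]
      · rw [if_pos (by omega)]
        rcases hδ with hd | hd <;> rw [hd] <;> simp [z]
    | succ m ih =>
      intro hm
      obtain ⟨ih1, ih2⟩ := ih (by omega)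
      have hnk : n - k = σ z := by omega
      rw [hnk] at ih1 ⊢
      have hcase : ∀ t, t < 2 * n → t % n = if t < n then t else t - n := by
        intro t ht
        split_ifs with h1
        · exact Nat.mod_eq_of_lt h1
        · rw [Nat.mod_eq_sub_mod (by omega), Nat.mod_eq_of_lt (by omega)]
      rw [hcase _ (by omega)] at ih1 ⊢
      have hsg := hε ⟨m + 1, hm⟩
      have hsz := hε z
      rcases h ⟨m, by omega⟩ ⟨m + 1, hm⟩ rfl with ⟨h1, h2⟩ | ⟨h1, h2, h3⟩
      · have hlt := (σ ⟨m + 1, hm⟩).isLt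
        have hiff : m < k ↔ m + 1 < k := by
          split_ifs at ih1 <;> omega
        refine ⟨by split_ifs at ih1 ⊢ <;> omega, ?_⟩
        simp only [← hiff]
        rw [← ih2]
        rcases hε ⟨m, by omega⟩ with he | he <;> rcases hsg with hs | hs <;>
          rw [he, hs] at h2 ⊢ <;> norm_num at h2
      · have hmk : m + 1 = k := by split_ifs at ih1 <;> omega
        refine ⟨by rw [if_neg (by omega)]; omega, ?_⟩
        rw [if_pos (by omega)] at ih2
        rw [if_neg (by omega)]
        change 0 < _ * δ at h3
        rw [ih2] at h3
        rcases hδ with hd | hd <;> rcases hsg with hs | hs <;> rcases hsz with hs' | hs' <;>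
          rw [hd, hs, hs'] at h3 ⊢ <;> norm_num at h3 <;> norm_num
  have hcyc : cycFun n c ^ k ∈ G := pow_mem (Submonoid.subset_closure (by simp)) k
  have hneg : negFun n ∈ G := Submonoid.subset_closure (by simp)
  have happ : ∀ x i, ε i * x (σ i) = ε z * δ * (cycFun n c ^ k) x i := by
    intro x i
    obtain ⟨h1, h2⟩ := key i i.isLt
    rw [cycFun_pow_apply hn c k (by omega), ← mul_assoc]
    have h3 : σ i = ⟨((i : ℕ) + (n - k)) % n, Nat.mod_lt _ hn⟩ := Fin.ext h1
    rw [h3]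
    congr 1
  have hs : ε z * δ = 1 ∨ ε z * δ = -1 := by
    rcases hε z with h1 | h1 <;> rcases hδ with h2 | h2 <;> rw [h1, h2] <;> norm_num
  rcases hs with hs | hs
  · have he : (fun x : Fin n → ℝ => fun i => ε i * x (σ i)) = cycFun n c ^ k := by
      funext x i
      rw [happ, hs, one_mul]
    exact he ▸ hcyc
  · have he : (fun x : Fin n → ℝ => fun i => ε i * x (σ i)) = negFun n * cycFun n c ^ k := by
      funext x i
      rw [happ, hs, neg_one_mul]
      rfl
    exact he ▸ mul_mem hneg hcyc

theorem CyclicStep.rev {n c : ℕ} {a b : Fin n} {e : ℝ} (h : CyclicStep n c b a e) :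
    CyclicStep n c a.rev b.rev e := by
  have ha := a.isLt
  have hb := b.isLt
  rcases h with ⟨h1, h2⟩ | ⟨h1, h2, h3⟩
  · exact Or.inl ⟨by simp only [Fin.val_rev]; omega, h2⟩
  · exact Or.inr ⟨by simp only [Fin.val_rev]; omega, by simp only [Fin.val_rev]; omega, h3⟩

/-- If each step is an ascending or a descending cyclic step, all steps have the same direction. -/
theorem cyclicStep_all_or_all {n c : ℕ} (hn : 3 ≤ n) (σ : Equiv.Perm (Fin n)) (ε : Fin n → ℝ)
    (h : ∀ a b : Fin n, (b : ℕ) = a + 1 →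
      CyclicStep n c (σ a) (σ b) (ε a * ε b) ∨ CyclicStep n c (σ b) (σ a) (ε a * ε b)) :
    (∀ a b : Fin n, (b : ℕ) = a + 1 → CyclicStep n c (σ a) (σ b) (ε a * ε b)) ∨
    (∀ a b : Fin n, (b : ℕ) = a + 1 → CyclicStep n c (σ b) (σ a) (ε a * ε b)) := by
  have hturn : ∀ {u v w : Fin n} {e e' : ℝ}, (w : ℕ) = u + 2 →
      ¬ (CyclicStep n c (σ u) (σ v) e ∧ CyclicStep n c (σ w) (σ v) e') ∧
      ¬ (CyclicStep n c (σ v) (σ u) e ∧ CyclicStep n c (σ v) (σ w) e') := by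
    intro u v w e e' huw
    have hne : (σ u : ℕ) ≠ σ w := fun hh => by
      have := σ.injective (Fin.ext hh)
      rw [this] at huw; omega
    have hu := (σ u).isLt
    have hv := (σ v).isLt
    have hw := (σ w).isLt
    constructor
    · rintro ⟨h1 | h1, h2 | h2⟩ <;> omega
    · rintro ⟨h1 | h1, h2 | h2⟩ <;> omega
  rcases h ⟨0, by omega⟩ ⟨1, by omega⟩ rfl with h0 | h0
  · left
    have : ∀ m (hm : m + 1 < n), CyclicStep n c (σ ⟨m, by omega⟩) (σ ⟨m + 1, hm⟩)
        (ε ⟨m, by omega⟩ * ε ⟨m + 1, hm⟩) := by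
      intro m
      induction m with
      | zero => exact fun _ => h0
      | succ m ih =>
        intro hm
        refine (h ⟨m + 1, by omega⟩ ⟨m + 2, hm⟩ rfl).resolve_right fun hh => ?_
        exact (hturn rfl).1 ⟨ih (by omega), hh⟩
    rintro ⟨a, ha⟩ ⟨b, hb⟩ hab
    obtain rfl : b = a + 1 := hab
    exact this a hb
  · right
    have : ∀ m (hm : m + 1 < n), CyclicStep n c (σ ⟨m + 1, hm⟩) (σ ⟨m, by omega⟩)
        (ε ⟨m, by omega⟩ * ε ⟨m + 1, hm⟩) := by
      intro m
      induction m with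
      | zero => exact fun _ => h0
      | succ m ih =>
        intro hm
        refine (h ⟨m + 1, by omega⟩ ⟨m + 2, hm⟩ rfl).resolve_left fun hh => ?_
        exact (hturn rfl).2 ⟨ih (by omega), hh⟩
    rintro ⟨a, ha⟩ ⟨b, hb⟩ hab
    obtain rfl : b = a + 1 := hab
    exact this a hb

/-- For `n ≥ 4` and `2 ≤ c ≤ n-2`, a signed coordinate permutation maps
every positive `c`-dimensional subspace of `ℝⁿ` to a positive `c`-dimensional subspace if
and only if it belongs to the subgroup generated by `cyc_c`, `rev` and `-id` (since these
generators have finite order, this subgroup coincides with the generated submonoid). -/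
theorem stmt8 {n c : ℕ} (hn : 4 ≤ n) (hc1 : 2 ≤ c) (hc2 : c ≤ n - 2)
    (σ : Equiv.Perm (Fin n)) (ε : Fin n → ℝ) (hε : ∀ i, ε i = 1 ∨ ε i = -1) :
    (∀ L : Submodule ℝ (Fin n → ℝ), IsPositiveSubspace c L →
        IsPositiveSubspace c (L.map (signedPermLin σ ε))) ↔
      (fun x : Fin n → ℝ => fun i => ε i * x (σ i)) ∈
        Submonoid.closure ({cycFun n c, revFun n, negFun n} : Set (Function.End (Fin n → ℝ))) := by
  constructor
  · intro h
    rcases cyclicStep_all_or_all (by omega) σ ε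
      (fun a b hab => cyclicStep_or_of_preserves hc1 (by omega) σ ε hε h hab) with hup | hdown
    · exact mem_closure_of_cyclicStep (by omega) σ ε hε hup
    · have h1 := mem_closure_of_cyclicStep (c := c) (by omega) (fun i => (σ i).rev) ε hε
        fun a b hab => (hdown a b hab).rev
      have h2 : revFun n ∈ Submonoid.closure
          ({cycFun n c, revFun n, negFun n} : Set (Function.End (Fin n → ℝ))) :=
        Submonoid.subset_closure (by simp)
      have he : (fun x : Fin n → ℝ => fun i => ε i * x (σ i)) =
          HMul.hMul (α := Function.End (Fin n → ℝ)) (fun x i => ε i * x (σ i).rev)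
            (revFun n) := by
        funext x i
        change _ = ε i * x (σ i).rev.rev
        rw [Fin.rev_rev]
      exact he ▸ mul_mem h1 h2
  · intro h L hL
    obtain ⟨g, hg, hpos⟩ := preservesPositive_of_mem_closure (by omega) (by omega) h
    have : signedPermLin σ ε = g := DFunLike.coe_injective hg.symm
    rw [this]
    exact hpos L hL
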